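/- arXiv:1810.04870 — 2 statements merged into one kernel-verified Lean document; each statement's English description precedes it below -/
import Mathlib

section
/- Let n ≥ 4 and let G be a unicyclic simple graph on n vertices. Then the path spectral radius satisfies ρ(G) ≥ (n + √(n² − 4n + 28)) / 2, with equality if and only if the cycle of G has length 3. -/
open SimpleGraph Polynomial

/-- Two walks from `u` to `v` are *internally disjoint* if their supports
meet only in the endpoints `u` and `v`. -/
def InternallyDisjoint {V : Type*} {G : SimpleGraph V} {u v : V}
    (p q : G.Walk u v) : Prop :=
  ∀ w, w ∈ p.support → w ∈ q.support → w = u ∨ w = v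

/-- The maximum number of pairwise internally vertex-disjoint paths from `u` to `v`. -/
noncomputable def maxDisjointPaths {V : Type*} (G : SimpleGraph V) (u v : V) : ℕ :=
  sSup {m : ℕ | ∃ f : Fin m → G.Path u v, Function.Injective f ∧
    ∀ i j, i ≠ j → InternallyDisjoint (f i).1 (f j).1}

/-- The path matrix of a graph on `Fin n`. -/
noncomputable def pathMatrix {n : ℕ} (G : SimpleGraph (Fin n)) :
    Matrix (Fin n) (Fin n) ℝ :=
  Matrix.of fun i j => if i = j then 0 else (maxDisjointPaths G i j : ℝ)

/-- The path energy: sum of the absolute values of the eigenvalues of the path matrix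
(the roots, with multiplicity, of its characteristic polynomial). -/
noncomputable def pathEnergy {n : ℕ} (G : SimpleGraph (Fin n)) : ℝ :=
  ((pathMatrix G).charpoly.roots.map (fun x => |x|)).sum

/-- The path spectral radius: the largest eigenvalue of the path matrix. -/
noncomputable def pathSpectralRadius {n : ℕ} (G : SimpleGraph (Fin n)) : ℝ :=
  sSup {x : ℝ | (pathMatrix G).charpoly.IsRoot x}

namespace SimpleGraph

variable {V : Type*} {G : SimpleGraph V} {u v : V}

/-- In a connected graph with as many edges as vertices, deleting a non-bridge gives a tree. -/
lemma Connected.isTree_deleteEdges_of_not_isBridge [Finite V] (hG : G.Connected)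
    (hcard : Nat.card G.edgeSet = Nat.card V) {e : Sym2 V} (he : e ∈ G.edgeSet)
    (hb : ¬ G.IsBridge e) : (G.deleteEdges {e}).IsTree := by
  rw [isTree_iff_connected_and_card]
  induction e with | h x y =>
  refine ⟨hG.connected_delete_edge_of_not_isBridge hb, ?_⟩
  rw [← hcard, edgeSet_deleteEdges, Nat.card_coe_set_eq, Nat.card_coe_set_eq]
  exact Set.ncard_sdiff_singleton_add_one he

namespace Walk

lemma IsPath.mk_start_snd_notMem_edges {p q : G.Walk u v} (hp : p.IsPath) (hq : q.IsPath)
    (huv : u ≠ v) (hpq : p ≠ q) (h : InternallyDisjoint p q) : s(u, p.snd) ∉ q.edges := by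
  intro hmem
  have hnil : ¬ p.Nil := not_nil_of_ne huv
  obtain hs | hs := h p.snd (p.getVert_mem_support 1) (q.snd_mem_support_of_mem_edges hmem)
  · exact (p.adj_snd hnil).ne hs.symm
  · have hp' : s(u, v) ∈ p.edges := by
      simpa only [hs] using p.mk_start_snd_mem_edges hnil
    rw [hs] at hmem
    exact hpq ((hp.eq_adj_toWalk_of_mem_edges hp').trans (hq.eq_adj_toWalk_of_mem_edges hmem).symm)

lemma IsPath.not_isBridge_start_snd {p q : G.Walk u v} (hp : p.IsPath) (hq : q.IsPath)
    (huv : u ≠ v) (hpq : p ≠ q) (h : InternallyDisjoint p q) : ¬ G.IsBridge s(u, p.snd) := by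
  rw [isBridge_iff, not_not]
  have hnil : ¬ p.Nil := not_nil_of_ne huv
  have htail : s(u, p.snd) ∉ p.tail.edges := by
    intro hmem
    have hu := p.tail.fst_mem_support_of_mem_edges hmem
    rw [support_tail_of_not_nil _ hnil] at hu
    have := hp.support_nodup
    rw [← cons_tail_support, List.nodup_cons] at this
    exact this.1 hu
  exact (q.toDeleteEdge _ (hp.mk_start_snd_notMem_edges hq huv hpq h)).reachable.trans
    (p.tail.toDeleteEdge _ htail).reachable.symm

/-- In a connected graph with as many edges as vertices, an end of two internally disjoint paths
lies on every cycle. -/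
lemma IsCycle.start_mem_support_of_internallyDisjoint [Finite V] (hG : G.Connected)
    (hcard : Nat.card G.edgeSet = Nat.card V) {x : V} {c : G.Walk x x} (hc : c.IsCycle)
    {p q : G.Walk u v} (hp : p.IsPath) (hq : q.IsPath)
    (huv : u ≠ v) (hpq : p ≠ q) (h : InternallyDisjoint p q) : u ∈ c.support := by
  have htree := hG.isTree_deleteEdges_of_not_isBridge hcard
    (p.adj_snd (not_nil_of_ne huv)) (hp.not_isBridge_start_snd hq huv hpq h)
  by_contra hu
  exact htree.isAcyclic (c.toDeleteEdge s(u, p.snd) fun hmem ↦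
    hu (c.fst_mem_support_of_mem_edges hmem)) (hc.transfer _)

lemma eq_of_internallyDisjoint [Finite V] (hG : G.Connected)
    (hcard : Nat.card G.edgeSet = Nat.card V) {p q r : G.Walk u v} (hp : p.IsPath)
    (hq : q.IsPath) (hr : r.IsPath) (huv : u ≠ v) (hpq : p ≠ q) (hpr : p ≠ r)
    (h : InternallyDisjoint p q) (h' : InternallyDisjoint p r) : q = r := by
  have htree := hG.isTree_deleteEdges_of_not_isBridge hcard
    (p.adj_snd (not_nil_of_ne huv)) (hp.not_isBridge_start_snd hq huv hpq h)
  have hq' := hp.mk_start_snd_notMem_edges hq huv hpq h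
  have hr' := hp.mk_start_snd_notMem_edges hr huv hpr h'
  have := (htree.isAcyclic.subsingleton_path u v).elim
    ⟨q.toDeleteEdge _ hq', hq.transfer _⟩ ⟨r.toDeleteEdge _ hr', hr.transfer _⟩
  apply edges_injective
  simpa using congrArg (fun w ↦ w.1.edges) this

/-- Two distinct vertices of a cycle are joined by two internally disjoint paths. -/
lemma IsCycle.exists_internallyDisjoint {x : V} {c : G.Walk x x} (hc : c.IsCycle)
    (hu : u ∈ c.support) (hv : v ∈ c.support) (huv : u ≠ v) :
    ∃ p q : G.Path u v, p ≠ q ∧ InternallyDisjoint p.1 q.1 := by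
  classical
  have hv' : v ∈ (c.rotate u hu).support := (mem_support_rotate_iff c u hu).2 hv
  have hc' : (c.rotate u hu).IsCycle := hc.rotate hu
  generalize c.rotate u hu = d at hv' hc'
  rw [← d.take_spec hv'] at hc'
  have hp := hc'.isPath_of_append_left (not_nil_of_ne huv.symm)
  have hq := hc'.isPath_of_append_right (not_nil_of_ne huv)
  generalize d.takeUntil v hv' = p at hp hc'
  generalize d.dropUntil v hv' = q at hq hc'
  refine ⟨⟨p, hp⟩, ⟨q.reverse, hq.reverse⟩, fun h ↦ ?_, fun w hw hw' ↦ ?_⟩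
  · have h : p = q.reverse := congrArg Subtype.val h
    have hnd := hc'.isTrail.edges_nodup
    rw [edges_append, List.nodup_append'] at hnd
    have hmem := p.mk_start_snd_mem_edges (not_nil_of_ne huv)
    refine hnd.2.2 hmem ?_
    rw [h] at hmem ⊢
    simpa using hmem
  · by_contra! hne
    have hnd := hc'.support_nodup
    rw [tail_support_append, List.nodup_append'] at hnd
    rw [support_reverse, List.mem_reverse, ← cons_tail_support, List.mem_cons] at hw'
    rw [← cons_tail_support, List.mem_cons] at hw
    exact hnd.2.2 (hw.resolve_left hne.1) (hw'.resolve_left hne.2)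

lemma IsCycle.card_support_toFinset [DecidableEq V] {c : G.Walk u u} (hc : c.IsCycle) :
    c.support.toFinset.card = c.length := by
  have hmem := c.end_mem_tail_support hc.not_nil
  rw [← cons_tail_support, List.toFinset_cons, Finset.insert_eq_of_mem (by simpa using hmem),
    List.toFinset_card_of_nodup hc.support_nodup, List.length_tail, length_support,
    Nat.add_sub_cancel]

end Walk

lemma Connected.exists_isCycle_of_card_edgeSet_eq [Finite V] (hG : G.Connected)
    (hcard : Nat.card G.edgeSet = Nat.card V) : ∃ (x : V) (c : G.Walk x x), c.IsCycle := by
  by_contra! h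
  have := (isTree_iff_connected_and_card.1 ⟨hG, fun x c ↦ h x c⟩).2
  lia

end SimpleGraph

lemma InternallyDisjoint.reverse {V : Type*} {G : SimpleGraph V} {u v : V} {p q : G.Walk u v}
    (h : InternallyDisjoint p q) : InternallyDisjoint p.reverse q.reverse := fun w hp hq ↦
  (h w (by simpa using hp) (by simpa using hq)).symm

lemma maxDisjointPaths_unicyclic {V : Type*} [Finite V] {G : SimpleGraph V} (hG : G.Connected)
    (hcard : Nat.card G.edgeSet = Nat.card V) {x : V} {c : G.Walk x x} (hc : c.IsCycle)
    {u v : V} (huv : u ≠ v) [Decidable (u ∈ c.support ∧ v ∈ c.support)] :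
    maxDisjointPaths G u v = if u ∈ c.support ∧ v ∈ c.support then 2 else 1 := by
  apply IsGreatest.csSup_eq
  split_ifs with h
  · obtain ⟨p, q, hpq, hd⟩ := hc.exists_internallyDisjoint h.1 h.2 huv
    refine ⟨⟨![p, q], ?_, ?_⟩, ?_⟩
    · intro i j hij
      fin_cases i <;> fin_cases j <;> simp_all [eq_comm]
    · intro i j hij
      fin_cases i <;> fin_cases j
      · exact absurd rfl hij
      · exact hd
      · exact fun w hw hw' ↦ hd w hw' hw
      · exact absurd rfl hij
    · rintro m ⟨f, hf, hd⟩
      by_contra! hm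
      have h01 : (⟨0, by lia⟩ : Fin m) ≠ ⟨1, by lia⟩ := by simp
      have h02 : (⟨0, by lia⟩ : Fin m) ≠ ⟨2, by lia⟩ := by simp
      have h12 : (⟨1, by lia⟩ : Fin m) ≠ ⟨2, by lia⟩ := by simp
      exact hf.ne h12 <| Subtype.ext <| Walk.eq_of_internallyDisjoint hG hcard (f _).2 (f _).2
        (f _).2 huv (Subtype.val_injective.ne (hf.ne h01)) (Subtype.val_injective.ne (hf.ne h02))
        (hd _ _ h01) (hd _ _ h02)
  · obtain ⟨p, hp⟩ := hG.exists_isPath u v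
    refine ⟨⟨fun _ ↦ ⟨p, hp⟩, Function.injective_of_subsingleton _,
      fun i j hij ↦ absurd (Subsingleton.elim i j) hij⟩, ?_⟩
    rintro m ⟨f, hf, hd⟩
    by_contra! hm
    have h01 : (⟨0, by lia⟩ : Fin m) ≠ ⟨1, hm⟩ := by simp
    have hne := Subtype.val_injective.ne (hf.ne h01)
    exact h ⟨hc.start_mem_support_of_internallyDisjoint hG hcard (f _).2 (f _).2 huv hne
        (hd _ _ h01),
      hc.start_mem_support_of_internallyDisjoint hG hcard (f _).2.reverse (f _).2.reverse huv.symm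
        (Walk.reverse_injective.ne hne) (hd _ _ h01).reverse⟩

namespace Matrix

variable {ι : Type*} [Fintype ι] [DecidableEq ι]

lemma charpoly_isRoot_iff_exists_mulVec_eq {K : Type*} [Field K] {M : Matrix ι ι K} {μ : K} :
    M.charpoly.IsRoot μ ↔ ∃ v ≠ 0, M *ᵥ v = μ • v := by
  rw [Polynomial.IsRoot, eval_charpoly, ← exists_mulVec_eq_zero_iff]
  simp [sub_mulVec, sub_eq_zero, eq_comm]

/-- An eigenvalue of a nonnegative matrix with a positive eigenvector is the largest one. -/
lemma isGreatest_charpoly_isRoot_of_mulVec_eq [Nonempty ι] {M : Matrix ι ι ℝ}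
    (hM : ∀ i j, 0 ≤ M i j) {x : ι → ℝ} (hx : ∀ i, 0 < x i) {r : ℝ} (h : M *ᵥ x = r • x) :
    IsGreatest {μ : ℝ | M.charpoly.IsRoot μ} r := by
  refine ⟨charpoly_isRoot_iff_exists_mulVec_eq.2 ⟨x, ?_, h⟩, fun μ hμ ↦ ?_⟩
  · obtain ⟨i⟩ := ‹Nonempty ι›
    exact fun h0 ↦ (hx i).ne' (congrFun h0 i)
  obtain ⟨y, hy, hy'⟩ := charpoly_isRoot_iff_exists_mulVec_eq.1 hμ
  obtain ⟨i, hi⟩ := Finite.exists_max fun i ↦ |y i| / x i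
  have hle : ∀ j, |y j| ≤ |y i| / x i * x j := fun j ↦ (div_le_iff₀ (hx j)).1 (hi j)
  have hpos : 0 < |y i| := by
    obtain ⟨j, hj⟩ := Function.ne_iff.1 hy
    have := (div_pos (abs_pos.2 hj) (hx j)).trans_le (hi j)
    by_contra! h0
    exact this.not_ge (div_nonpos_of_nonpos_of_nonneg h0 (hx i).le)
  have hr : |y i| / x i * ∑ j, M i j * x j = r * |y i| := by
    have := congrFun h i
    simp only [mulVec, dotProduct, Pi.smul_apply, smul_eq_mul] at this
    rw [this]
    field_simp [(hx i).ne']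
  refine le_of_mul_le_mul_right ?_ hpos
  calc μ * |y i| ≤ |μ * y i| := by rw [abs_mul]; gcongr; exact le_abs_self μ
    _ = |∑ j, M i j * y j| := by
      have := congrFun hy' i
      simp only [mulVec, dotProduct, Pi.smul_apply, smul_eq_mul] at this
      rw [this]
    _ ≤ ∑ j, |M i j * y j| := Finset.abs_sum_le_sum_abs _ _
    _ ≤ ∑ j, |y i| / x i * (M i j * x j) := by
      gcongr with j
      rw [abs_mul, abs_of_nonneg (hM i j), mul_left_comm]
      exact mul_le_mul_of_nonneg_left (hle j) (hM i j)
    _ = r * |y i| := by rw [← Finset.mul_sum, hr]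

/-- The largest eigenvalue of the matrix with zero diagonal whose off-diagonal entries are `2`
inside a block of size `k` and `1` elsewhere. -/
lemma isGreatest_charpoly_isRoot_twoBlock {C : Finset ι} (hC : C.Nonempty) {r : ℝ}
    (hr : (Fintype.card ι : ℝ) - C.card - 1 < r)
    (h : r ^ 2 - (Fintype.card ι + C.card - 3) * r
      + (2 * (C.card - 1) * (Fintype.card ι - C.card - 1)
        - C.card * (Fintype.card ι - C.card)) = 0) :
    IsGreatest {μ : ℝ | (Matrix.of fun i j : ι ↦
      if i = j then (0 : ℝ) else if i ∈ C ∧ j ∈ C then 2 else 1).charpoly.IsRoot μ} r := by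
  have := hC.to_type
  set x : ι → ℝ := fun i ↦ if i ∈ C then r - (Fintype.card ι - C.card - 1) else C.card with hx
  have hcard : (0 : ℝ) < C.card := by exact_mod_cast hC.card_pos
  refine isGreatest_charpoly_isRoot_of_mulVec_eq (x := x) (fun i j ↦ ?_) (fun i ↦ ?_) ?_
  · rw [of_apply]; split_ifs <;> norm_num
  · simp only [hx]; split_ifs <;> linarith
  have hsum : ∑ j ∈ C, x j = C.card * (r - (Fintype.card ι - C.card - 1)) := by
    rw [Finset.sum_congr rfl fun j hj ↦ if_pos hj, Finset.sum_const, nsmul_eq_mul]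
  have hsumc : ∑ j ∈ Cᶜ, x j = (Fintype.card ι - C.card) * C.card := by
    rw [Finset.sum_congr rfl fun j hj ↦ if_neg (Finset.mem_compl.1 hj), Finset.sum_const,
      nsmul_eq_mul, Finset.card_compl, Nat.cast_sub (Finset.card_le_univ C)]
  ext i
  simp only [mulVec, dotProduct, of_apply, Pi.smul_apply, smul_eq_mul]
  have hentry : ∀ j, (if i = j then (0 : ℝ) else if i ∈ C ∧ j ∈ C then 2 else 1) * x j
      = x j + (if j ∈ C then if i ∈ C then x j else 0 else 0)
        - (if i = j then if i ∈ C then 2 * x j else x j else 0) := by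
    intro j
    by_cases hij : i = j
    · subst hij
      by_cases hi : i ∈ C <;> simp [hi]; ring
    · by_cases hi : i ∈ C <;> by_cases hj : j ∈ C <;> simp [hij, hi, hj]; ring
  rw [Finset.sum_congr rfl fun j _ ↦ hentry j, Finset.sum_sub_distrib, Finset.sum_add_distrib,
    ← Finset.sum_add_sum_compl C x, Finset.sum_ite_eq, ← Finset.sum_filter]
  by_cases hi : i ∈ C
  · simp only [hi, if_true, Finset.mem_univ, Finset.filter_univ_mem, hsum, hsumc]
    simp only [hx, hi, if_true]
    linear_combination -h
  · simp only [hi, if_false, Finset.mem_univ, if_true, Finset.sum_const_zero, hsum, hsumc]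
    simp only [hx, hi, if_false]
    ring

end Matrix

lemma pathSpectralRadius_unicyclic {n : ℕ} {G : SimpleGraph (Fin n)} (hG : G.Connected)
    (hcard : Nat.card G.edgeSet = n) {x : Fin n} {c : G.Walk x x} (hc : c.IsCycle) {r : ℝ}
    (hr : (n : ℝ) - c.length - 1 < r)
    (h : r ^ 2 - (n + c.length - 3) * r
      + (2 * (c.length - 1) * (n - c.length - 1) - c.length * (n - c.length)) = 0) :
    pathSpectralRadius G = r := by
  have hM : pathMatrix G = Matrix.of fun i j ↦ if i = j then (0 : ℝ) else
      if i ∈ c.support.toFinset ∧ j ∈ c.support.toFinset then 2 else 1 := by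
    ext i j
    simp only [pathMatrix, Matrix.of_apply, List.mem_toFinset]
    split_ifs with hij hmem
    · rfl
    · rw [maxDisjointPaths_unicyclic hG (by simpa using hcard) hc hij, if_pos hmem, Nat.cast_ofNat]
    · rw [maxDisjointPaths_unicyclic hG (by simpa using hcard) hc hij, if_neg hmem, Nat.cast_one]
  rw [pathSpectralRadius, hM]
  apply IsGreatest.csSup_eq
  apply Matrix.isGreatest_charpoly_isRoot_twoBlock ⟨x, by simp⟩ <;>
    simpa only [Fintype.card_fin, hc.card_support_toFinset]

/-- for a unicyclic graph on n ≥ 4 vertices,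
ρ(G) ≥ (n + √(n² − 4n + 28))/2, with equality iff the cycle has length 3. -/
theorem pathSpectralRadius_unicyclic_min {n : ℕ} (hn : 4 ≤ n)
    (G : SimpleGraph (Fin n)) (hG : G.Connected)
    (hedges : Nat.card G.edgeSet = n) :
    ((n : ℝ) + Real.sqrt ((n : ℝ) ^ 2 - 4 * n + 28)) / 2 ≤ pathSpectralRadius G ∧
      (pathSpectralRadius G = ((n : ℝ) + Real.sqrt ((n : ℝ) ^ 2 - 4 * n + 28)) / 2 ↔
        ∃ (x : Fin n) (c : G.Walk x x), c.IsCycle ∧ c.length = 3) := by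
  have hn' : (4 : ℝ) ≤ n := by exact_mod_cast hn
  set μ := ((n : ℝ) + Real.sqrt ((n : ℝ) ^ 2 - 4 * n + 28)) / 2 with hμ_def
  have hμ : μ ^ 2 - n * μ + (n - 7) = 0 := by
    have := Real.sq_sqrt (x := (n : ℝ) ^ 2 - 4 * n + 28) (by nlinarith)
    rw [hμ_def]
    linear_combination this / 4
  have hμ_lt : (n : ℝ) - 3 < μ := by
    have : (n : ℝ) - 2 ≤ Real.sqrt ((n : ℝ) ^ 2 - 4 * n + 28) :=
      Real.le_sqrt_of_sq_le (by linarith)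
    linarith
  have htri {x : Fin n} {c : G.Walk x x} (hc : c.IsCycle) (h3 : c.length = 3) :
      pathSpectralRadius G = μ := by
    apply pathSpectralRadius_unicyclic hG hedges hc <;> rw [h3]
    · push_cast; linarith
    · push_cast; linear_combination hμ
  have hlong {x : Fin n} {c : G.Walk x x} (hc : c.IsCycle) (h3 : c.length ≠ 3) :
      μ < pathSpectralRadius G := by
    have hk : (3 : ℝ) < c.length := by
      exact_mod_cast lt_of_le_of_ne hc.three_le_length h3.symm
    set k : ℝ := (c.length : ℝ)
    set s : ℝ := n + k - 3 with hs
    set q : ℝ := 2 * (k - 1) * (n - k - 1) - k * (n - k) with hq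
    have hneg : μ ^ 2 - s * μ + q < 0 := by
      have : μ ^ 2 - s * μ + q = (k - 3) * (n - k - 3 - μ) := by
        rw [hs, hq]; linear_combination hμ
      rw [this]
      exact mul_neg_of_pos_of_neg (by linarith) (by linarith)
    have hdisc : (2 * μ - s) ^ 2 < s ^ 2 - 4 * q := by linarith
    have hroot := Real.sq_sqrt ((sq_nonneg _).trans hdisc.le)
    have hlt : μ < (s + Real.sqrt (s ^ 2 - 4 * q)) / 2 := by
      linarith [Real.lt_sqrt_of_sq_lt hdisc]
    have hk_lt : (n : ℝ) - k - 1 < (s + Real.sqrt (s ^ 2 - 4 * q)) / 2 := by linarith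
    rwa [pathSpectralRadius_unicyclic hG hedges hc hk_lt (by linear_combination hroot / 4)]
  obtain ⟨x, c, hc⟩ := hG.exists_isCycle_of_card_edgeSet_eq (by simpa using hedges)
  by_cases h3 : c.length = 3
  · exact ⟨(htri hc h3).ge, fun _ ↦ ⟨x, c, hc, h3⟩, fun _ ↦ htri hc h3⟩
  · exact ⟨(hlong hc h3).le, fun h ↦ absurd h (hlong hc h3).ne',
      fun ⟨_, _, hd, hd3⟩ ↦ htri hd hd3⟩
end

section
/- For a fixed number n of vertices, the path energy of a unicyclic graph on n vertices depends only on n and on the length k of its unique cycle, and it is a strictly increasing function of k for 3 ≤ k ≤ n: if G₁ and G₂ are unicyclic graphs on n vertices with cycle lengths k₁ < k₂, then PE(G₁) < PE(G₂), and if k₁ = k₂ then PE(G₁) = PE(G₂). -/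
open SimpleGraph Polynomial

namespace SimpleGraph

variable {V : Type*} {G : SimpleGraph V} {u v : V}

/-- In a connected graph with as many edges as vertices, deleting an edge of one cycle
destroys every cycle. -/
lemma Connected.edges_subset_of_isCycle [Finite V] (hG : G.Connected)
    (hcard : Nat.card G.edgeSet = Nat.card V) {c : G.Walk u u} {d : G.Walk v v}
    (hc : c.IsCycle) (hd : d.IsCycle) : c.edges ⊆ d.edges := by
  intro e he
  by_contra hed
  have hbridge : ¬ G.IsBridge e := fun h => h.notMem_edges_of_isCycle hc he
  have heG : e ∈ G.edgeSet := c.edges_subset_edgeSet he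
  induction e with | h x y =>
  have hcon := hG.connected_delete_edge_of_not_isBridge hbridge
  have htree : (G.deleteEdges {s(x, y)}).IsTree := by
    rw [isTree_iff_connected_and_card]
    refine ⟨hcon, ?_⟩
    rw [edgeSet_deleteEdges, ← hcard]
    simp only [Nat.card_coe_set_eq]
    exact Set.ncard_sdiff_singleton_add_one heG (Set.toFinite _)
  refine htree.isAcyclic _ (hd.transfer (H := G.deleteEdges {s(x, y)}) fun f hf => ?_)
  rw [edgeSet_deleteEdges]
  exact ⟨d.edges_subset_edgeSet hf, fun h => hed (h ▸ hf)⟩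

lemma Walk.eq_of_length_eq_one {p q : G.Walk u v} (hp : p.length = 1) (hq : q.length = 1) :
    p = q := by
  cases p with
  | nil => simp at hp
  | cons h p =>
    cases q with
    | nil => simp at hq
    | cons h' q =>
      cases p with
      | nil =>
        cases q with
        | nil => rfl
        | cons _ _ => simp at hq
      | cons _ _ => simp at hp

lemma Walk.IsPath.isCycle_append_reverse {p q : G.Walk u v} (hp : p.IsPath) (hq : q.IsPath)
    (huv : u ≠ v) (hpq : p ≠ q) (hdisj : InternallyDisjoint p q) :
    (p.append q.reverse).IsCycle := by
  refine hp.isCycle_append hq.reverse ?_ ?_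
  · intro w hwp hwq
    have hu : w ≠ u := by
      rintro rfl
      have := hp.support_nodup
      rw [← p.cons_tail_support] at this
      exact (List.nodup_cons.1 this).1 hwp
    have hv : w ≠ v := by
      rintro rfl
      have := hq.reverse.support_nodup
      rw [← q.reverse.cons_tail_support] at this
      exact (List.nodup_cons.1 this).1 hwq
    have hwq' : w ∈ q.support := by simpa using List.mem_of_mem_tail hwq
    exact (hdisj w (List.mem_of_mem_tail hwp) hwq').elim hu hv
  · have h1 : p.length ≠ 0 := fun h => huv (Walk.eq_of_length_eq_zero h)
    have h2 : q.length ≠ 0 := fun h => huv (Walk.eq_of_length_eq_zero h)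
    rw [Walk.length_reverse]
    by_contra! h
    exact hpq (Walk.eq_of_length_eq_one (by omega) (by omega))

lemma Walk.IsCycle.exists_internallyDisjoint_s17 {x : V} {c : G.Walk x x} (hc : c.IsCycle)
    (hu : u ∈ c.support) (hv : v ∈ c.support) (huv : u ≠ v) :
    ∃ p q : G.Path u v, p ≠ q ∧ InternallyDisjoint p.1 q.1 := by
  classical
  have hd := hc.rotate hu
  set d := c.rotate u hu
  have hvd : v ∈ d.support := by simpa [d] using hv
  set p := d.takeUntil v hvd
  set q := d.dropUntil v hvd
  have hpq : p.append q = d := d.take_spec hvd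
  rw [← hpq] at hd
  have hp : p.IsPath := hd.isPath_of_append_left (Walk.not_nil_of_ne huv.symm)
  have hq : q.IsPath := hd.isPath_of_append_right (Walk.not_nil_of_ne huv)
  have hnodup := hd.support_nodup
  rw [Walk.tail_support_append, List.nodup_append'] at hnodup
  refine ⟨⟨p, hp⟩, ⟨q.reverse, hq.reverse⟩, ?_, ?_⟩
  · intro h
    have h' : p = q.reverse := congrArg Subtype.val h
    have hedge := hd.isTrail.edges_nodup
    rw [Walk.edges_append, List.nodup_append'] at hedge
    have hne : p.edges ≠ [] := by
      intro h0
      exact huv (Walk.eq_of_length_eq_zero (by rw [← p.length_edges, h0]; rfl))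
    obtain ⟨e, he⟩ := List.exists_mem_of_ne_nil _ hne
    exact hedge.2.2 he (by simpa [h'] using he)
  · intro w hwp hwq
    by_contra! hw
    have hwq' : w ∈ q.support := by simpa using hwq
    rw [Walk.mem_support_iff] at hwp hwq'
    exact hnodup.2.2 (hwp.resolve_left hw.1) (hwq'.resolve_left hw.2)

lemma Walk.IsCycle.mem_support_of_edges_subset {x y : V} {c : G.Walk x x} {d : G.Walk y y}
    (hc : c.IsCycle) (h : c.edges ⊆ d.edges) : c.support ⊆ d.support := by
  intro w hw
  rw [Walk.mem_support_iff_exists_mem_edges_of_not_nil hc.not_nil] at hw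
  obtain ⟨e, he, hwe⟩ := hw
  exact d.mem_support_of_mem_edges (h he) hwe

lemma Walk.not_internallyDisjoint_triple {p q r : G.Walk u v} (hp : p.IsPath)
    (hq : q.IsPath) (hr : r.IsPath)
    (hcycle : ∀ {x y : V} {c : G.Walk x x} {d : G.Walk y y}, c.IsCycle → d.IsCycle →
      c.edges ⊆ d.edges) (huv : u ≠ v) (hpq : p ≠ q) (hpr : p ≠ r) (hqr : q ≠ r)
    (hpq' : InternallyDisjoint p q) (hpr' : InternallyDisjoint p r)
    (hqr' : InternallyDisjoint q r) : False := by
  have h1 := hp.isCycle_append_reverse hq huv hpq hpq'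
  have h2 := hp.isCycle_append_reverse hr huv hpr hpr'
  have h3 := hq.isCycle_append_reverse hr huv hqr hqr'
  have hne : q.edges ≠ [] := by
    intro h0
    exact huv (Walk.eq_of_length_eq_zero (by rw [← q.length_edges, h0]; rfl))
  obtain ⟨e, he⟩ := List.exists_mem_of_ne_nil _ hne
  have he2 : e ∈ (p.append r.reverse).edges := hcycle h1 h2 (by simp [he])
  have d1 := h1.isTrail.edges_nodup
  have d3 := h3.isTrail.edges_nodup
  rw [Walk.edges_append, List.nodup_append'] at d1 d3
  rw [Walk.edges_append, List.mem_append] at he2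
  rcases he2 with h | h
  · exact d1.2.2 h (by simpa using he)
  · exact d3.2.2 he h

variable [Finite V]

lemma Connected.maxDisjointPaths_eq (hG : G.Connected)
    (hcard : Nat.card G.edgeSet = Nat.card V) {x : V} {c : G.Walk x x} (hc : c.IsCycle)
    (huv : u ≠ v) [Decidable (u ∈ c.support ∧ v ∈ c.support)] :
    maxDisjointPaths G u v = if u ∈ c.support ∧ v ∈ c.support then 2 else 1 := by
  have hcycle : ∀ {x y : V} {c : G.Walk x x} {d : G.Walk y y}, c.IsCycle → d.IsCycle →
      c.edges ⊆ d.edges := hG.edges_subset_of_isCycle hcard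
  split_ifs with h
  · refine IsGreatest.csSup_eq ⟨?_, ?_⟩
    · obtain ⟨p, q, hpq, hd⟩ := hc.exists_internallyDisjoint_s17 h.1 h.2 huv
      have hd' : InternallyDisjoint q.1 p.1 := fun w h1 h2 => hd w h2 h1
      refine ⟨![p, q], ?_, ?_⟩
      · intro i j
        fin_cases i <;> fin_cases j <;> simp [hpq, hpq.symm]
      · intro i j
        fin_cases i <;> fin_cases j <;> simp [hd, hd']
    · rintro m ⟨f, hf, hd⟩
      by_contra! hm
      have hne : ∀ i j : Fin m, i ≠ j → (f i).1 ≠ (f j).1 := fun i j hij h =>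
        hij (hf (Subtype.ext h))
      have h01 : (⟨0, by omega⟩ : Fin m) ≠ ⟨1, by omega⟩ := by simp
      have h02 : (⟨0, by omega⟩ : Fin m) ≠ ⟨2, by omega⟩ := by simp
      have h12 : (⟨1, by omega⟩ : Fin m) ≠ ⟨2, by omega⟩ := by simp
      exact Walk.not_internallyDisjoint_triple (f _).2 (f _).2 (f _).2 hcycle huv
        (hne _ _ h01) (hne _ _ h02) (hne _ _ h12) (hd _ _ h01) (hd _ _ h02) (hd _ _ h12)
  · refine IsGreatest.csSup_eq ⟨?_, ?_⟩
    · obtain ⟨p, hp⟩ := hG.exists_isPath u v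
      exact ⟨fun _ => ⟨p, hp⟩, Function.injective_of_subsingleton _,
        fun i j hij => absurd (Subsingleton.elim i j) hij⟩
    · rintro m ⟨f, hf, hd⟩
      by_contra! hm
      have h01 : (⟨0, by omega⟩ : Fin m) ≠ ⟨1, by omega⟩ := by simp
      have hcyc := (f _).2.isCycle_append_reverse (f _).2 huv
        (fun h => h01 (hf (Subtype.ext h))) (hd _ _ h01)
      have hsub := hcyc.mem_support_of_edges_subset (hcycle hcyc hc)
      exact h ⟨hsub (by simp), hsub (by simp)⟩

lemma Walk.IsCycle.card_support_toFinset_s17 {V : Type*} [DecidableEq V] {G : SimpleGraph V} {x : V}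
    {c : G.Walk x x} (hc : c.IsCycle) : c.support.toFinset.card = c.length := by
  have h : c.support.toFinset = c.support.tail.toFinset := by
    ext w
    simp only [List.mem_toFinset]
    refine ⟨fun hw => ?_, List.mem_of_mem_tail⟩
    rcases c.mem_support_iff.1 hw with rfl | hw
    · exact c.end_mem_tail_support hc.not_nil
    · exact hw
  rw [h, List.toFinset_card_of_nodup hc.support_nodup]
  simp

end SimpleGraph

/-- The matrix with zero diagonal whose off-diagonal entries are `2` on the block indexed by `s`
and `1` elsewhere. -/
def blockMatrix {n : ℕ} (s : Finset (Fin n)) : Matrix (Fin n) (Fin n) ℝ :=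
  Matrix.of fun i j => if i = j then 0 else if i ∈ s ∧ j ∈ s then 2 else 1

lemma det_scalar_sub_blockMatrix {n : ℕ} (s : Finset (Fin n)) {t : ℝ}
    (h1 : t + 1 ≠ 0) (h2 : t + 2 ≠ 0) :
    (Matrix.scalar _ t - blockMatrix s).det * ((t + 2) * (t + 1)) =
      (t + 2) ^ s.card * (t + 1) ^ (n - s.card) *
        (t ^ 2 - (n + s.card - 3) * t + (n * s.card - s.card ^ 2 - 2 * n + 2)) := by
  set d : Fin n → ℝ := fun i => if i ∈ s then t + 2 else t + 1 with hd
  have hd0 : ∀ i, d i ≠ 0 := fun i => by simp only [hd]; split_ifs <;> assumption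
  set U : Matrix (Fin n) (Fin 2) ℝ := Matrix.of fun i => ![1, if i ∈ s then 1 else 0] with hU
  have hM : Matrix.scalar _ t - blockMatrix s = Matrix.diagonal d + (-U) * U.transpose := by
    ext i j
    by_cases hij : i = j
    · subst hij
      by_cases hi : i ∈ s <;>
        simp [blockMatrix, Matrix.mul_apply, Fin.sum_univ_two, hU, hd, hi] <;> ring
    · by_cases hi : i ∈ s <;> by_cases hj : j ∈ s <;>
        simp [blockMatrix, Matrix.mul_apply, Fin.sum_univ_two, hU, hd, hi, hj, hij] <;> norm_num
  have hdet : (Matrix.diagonal d).det = (t + 2) ^ s.card * (t + 1) ^ (n - s.card) := by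
    rw [Matrix.det_diagonal]
    simp only [hd, Finset.prod_ite, Finset.prod_const, Finset.filter_not, Finset.filter_mem_eq_inter,
      Finset.univ_inter]
    rw [← Finset.compl_eq_univ_sdiff, Finset.card_compl, Fintype.card_fin]
  have hunit : IsUnit (Matrix.diagonal d).det := by
    rw [hdet]
    exact (mul_ne_zero (pow_ne_zero _ h2) (pow_ne_zero _ h1)).isUnit
  have hinv : (Matrix.diagonal d)⁻¹ = Matrix.diagonal fun i => (d i)⁻¹ := by
    refine Matrix.inv_eq_right_inv ?_
    rw [Matrix.diagonal_mul_diagonal, ← Matrix.diagonal_one]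
    congr 1
    ext i
    exact mul_inv_cancel₀ (hd0 i)
  have hsum1 : ∑ i, (d i)⁻¹ = s.card * (t + 2)⁻¹ + (n - s.card) * (t + 1)⁻¹ := by
    simp only [hd, apply_ite Inv.inv, Finset.sum_ite, Finset.sum_const, Finset.filter_not,
      Finset.filter_mem_eq_inter, Finset.univ_inter, nsmul_eq_mul]
    rw [← Finset.compl_eq_univ_sdiff, Finset.card_compl, Fintype.card_fin,
      Nat.cast_sub (by simpa using s.card_le_univ)]
  have hsum2 : ∑ i, (if i ∈ s then (d i)⁻¹ else 0) = s.card * (t + 2)⁻¹ := by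
    rw [← Finset.sum_filter, Finset.filter_mem_eq_inter, Finset.univ_inter, ← nsmul_eq_mul,
      ← Finset.sum_const]
    exact Finset.sum_congr rfl fun i hi => by simp [hd, hi]
  have hsmall : 1 + U.transpose * (Matrix.diagonal d)⁻¹ * (-U) =
      !![1 - (s.card * (t + 2)⁻¹ + (n - s.card) * (t + 1)⁻¹), -(s.card * (t + 2)⁻¹);
        -(s.card * (t + 2)⁻¹), 1 - s.card * (t + 2)⁻¹] := by
    rw [hinv, ← hsum1, ← hsum2]
    ext i j
    rw [Matrix.add_apply, Matrix.mul_apply]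
    simp only [Matrix.mul_diagonal]
    fin_cases i <;> fin_cases j <;> simp [hU, sub_eq_add_neg]
  rw [hM, Matrix.det_add_mul _ _ hunit, hsmall, Matrix.det_fin_two_of, hdet]
  field_simp
  ring

lemma charpoly_blockMatrix_mul {n : ℕ} (s : Finset (Fin n)) {r₁ r₂ : ℝ}
    (hadd : r₁ + r₂ = n + s.card - 3)
    (hmul : r₁ * r₂ = n * s.card - s.card ^ 2 - 2 * n + 2) :
    (blockMatrix s).charpoly * ((X - C (-2)) * (X - C (-1))) =
      (X - C (-2)) ^ s.card * (X - C (-1)) ^ (n - s.card) * ((X - C r₁) * (X - C r₂)) := by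
  refine Polynomial.eq_of_infinite_eval_eq _ _ (Set.Infinite.mono (s := {-1, -2}ᶜ) ?_ ?_)
  · intro t ht
    simp only [Set.mem_compl_iff, Set.mem_insert_iff, Set.mem_singleton_iff, not_or] at ht
    have h := det_scalar_sub_blockMatrix s (t := t) (fun h => ht.1 (by linarith))
      (fun h => ht.2 (by linarith))
    rw [← hadd, ← hmul] at h
    simp only [Set.mem_ofPred_eq, eval_mul, eval_sub, eval_pow, eval_X, eval_C,
      Matrix.eval_charpoly, sub_neg_eq_add, h]
    ring
  · exact (Set.toFinite _).infinite_compl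

lemma sum_abs_roots_charpoly_blockMatrix {n : ℕ} (s : Finset (Fin n)) {r₁ r₂ : ℝ}
    (hadd : r₁ + r₂ = n + s.card - 3)
    (hmul : r₁ * r₂ = n * s.card - s.card ^ 2 - 2 * n + 2) :
    ((blockMatrix s).charpoly.roots.map fun x => |x|).sum =
      n + s.card - 3 + (|r₁| + |r₂|) := by
  have h := congrArg (fun p : ℝ[X] => (p.roots.map fun x => |x|).sum)
    (charpoly_blockMatrix_mul s hadd hmul)
  have hX : ∀ a : ℝ, X - C a ≠ 0 := X_sub_C_ne_zero
  have hc : (blockMatrix s).charpoly ≠ 0 := (Matrix.charpoly_monic _).ne_zero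
  have hs : s.card ≤ n := by simpa using s.card_le_univ
  have hpow : ∀ (a : ℝ) (m : ℕ), (X - C a) ^ m ≠ 0 := fun a m => pow_ne_zero m (hX a)
  rw [roots_mul (mul_ne_zero hc (mul_ne_zero (hX _) (hX _))),
    roots_mul (mul_ne_zero (hX _) (hX _)),
    roots_mul (mul_ne_zero (mul_ne_zero (hpow _ _) (hpow _ _)) (mul_ne_zero (hX _) (hX _))),
    roots_mul (mul_ne_zero (hpow _ _) (hpow _ _)), roots_mul (mul_ne_zero (hX _) (hX _)),
    roots_pow, roots_pow] at h
  simp only [roots_X_sub_C, Multiset.map_add, Multiset.sum_add, Multiset.map_singleton,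
    Multiset.sum_singleton, Multiset.map_nsmul, Multiset.sum_nsmul, nsmul_eq_mul,
    Nat.cast_sub hs, abs_neg, abs_one, abs_two] at h
  linarith

/-- The path energy of a unicyclic graph on `n` vertices with cycle length `k`. -/
noncomputable def unicyclicEnergy (n k : ℕ) : ℝ :=
  n + k - 3 + max (n + k - 3 : ℝ)
    (Real.sqrt ((n + k - 3) ^ 2 - 4 * (n * k - k ^ 2 - 2 * n + 2)))

lemma discriminant_nonneg {n k : ℝ} (hk : 3 ≤ k) (hkn : k ≤ n) :
    0 ≤ (n + k - 3) ^ 2 - 4 * (n * k - k ^ 2 - 2 * n + 2) := by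
  nlinarith [sq_nonneg (n - k)]

lemma sum_abs_eq_max {a b : ℝ} : |a| + |b| = max |a + b| |a - b| := by
  rcases abs_cases a with ⟨h1, _⟩ | ⟨h1, _⟩ <;> rcases abs_cases b with ⟨h2, _⟩ | ⟨h2, _⟩ <;>
  rcases abs_cases (a + b) with ⟨h3, _⟩ | ⟨h3, _⟩ <;>
  rcases abs_cases (a - b) with ⟨h4, _⟩ | ⟨h4, _⟩ <;>
  rcases max_cases |a + b| |a - b| with ⟨h5, _⟩ | ⟨h5, _⟩ <;>
  linarith

lemma sum_abs_roots_eq_unicyclicEnergy {n : ℕ} (s : Finset (Fin n)) (hs : 3 ≤ s.card) :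
    ((blockMatrix s).charpoly.roots.map fun x => |x|).sum = unicyclicEnergy n s.card := by
  have hsn : s.card ≤ n := by simpa using s.card_le_univ
  have hs' : (3 : ℝ) ≤ s.card := by exact_mod_cast hs
  have hsn' : (s.card : ℝ) ≤ n := by exact_mod_cast hsn
  have hsq := Real.sq_sqrt (discriminant_nonneg hs' hsn')
  unfold unicyclicEnergy
  set T : ℝ := n + s.card - 3 with hT
  set S := Real.sqrt (T ^ 2 - 4 * (n * s.card - s.card ^ 2 - 2 * n + 2)) with hS
  rw [sum_abs_roots_charpoly_blockMatrix s (r₁ := (T + S) / 2) (r₂ := (T - S) / 2)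
    (by rw [← hT]; ring) (by linear_combination (-1 / 4) * hsq), sum_abs_eq_max,
    show (T + S) / 2 + (T - S) / 2 = T by ring, show (T + S) / 2 - (T - S) / 2 = S by ring,
    abs_of_nonneg (by linarith : 0 ≤ T), abs_of_nonneg (Real.sqrt_nonneg _)]

lemma unicyclicEnergy_lt {n k l : ℕ} (hk : 3 ≤ k) (hkl : k < l) (hl : l ≤ n) :
    unicyclicEnergy n k < unicyclicEnergy n l := by
  have hk' : (3 : ℝ) ≤ k := by exact_mod_cast hk
  have hkl' : (k : ℝ) + 1 ≤ l := by exact_mod_cast hkl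
  have hl' : (l : ℝ) ≤ n := by exact_mod_cast hl
  unfold unicyclicEnergy
  refine add_lt_add (by linarith) (max_lt ?_ ?_)
  · exact lt_max_of_lt_left (by linarith)
  · rcases le_or_gt 0 ((n : ℝ) * k - k ^ 2 - 2 * n + 2) with h | h
    · refine lt_max_of_lt_left ?_
      rw [Real.sqrt_lt' (by linarith)]
      nlinarith
    · refine lt_max_of_lt_right (Real.sqrt_lt_sqrt ?_ ?_)
      · exact discriminant_nonneg hk' (by linarith)
      · have hn : (n : ℝ) ≤ k + 4 := by
          by_contra! h'
          nlinarith
        nlinarith [mul_pos (by linarith : (0 : ℝ) < l - k)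
          (by linarith : (0 : ℝ) < 5 * (k + l) - 2 * n - 6)]

lemma pathEnergy_eq_unicyclicEnergy {n : ℕ} {G : SimpleGraph (Fin n)} (hG : G.Connected)
    (hedges : Nat.card G.edgeSet = n) {x : Fin n} {c : G.Walk x x} (hc : c.IsCycle) :
    pathEnergy G = unicyclicEnergy n c.length := by
  have hmat : pathMatrix G = blockMatrix c.support.toFinset := by
    ext i j
    simp only [pathMatrix, blockMatrix, Matrix.of_apply, List.mem_toFinset]
    by_cases hij : i = j
    · simp [hij]
    · rw [if_neg hij, if_neg hij, hG.maxDisjointPaths_eq (by simpa using hedges) hc hij]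
      push_cast
      rfl
  have hcard := hc.card_support_toFinset_s17
  rw [pathEnergy, hmat, sum_abs_roots_eq_unicyclicEnergy _ (hcard ▸ hc.three_le_length), hcard]

/-- the path energy of a unicyclic graph on n vertices depends
only on n and the cycle length k, and is strictly increasing in k for 3 ≤ k ≤ n. -/
theorem pathEnergy_unicyclic_monotone {n k₁ k₂ : ℕ}
    (G₁ G₂ : SimpleGraph (Fin n))
    (hG₁ : G₁.Connected) (hedges₁ : Nat.card G₁.edgeSet = n)
    (hG₂ : G₂.Connected) (hedges₂ : Nat.card G₂.edgeSet = n)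
    (x₁ : Fin n) (c₁ : G₁.Walk x₁ x₁) (hc₁ : c₁.IsCycle) (hlen₁ : c₁.length = k₁)
    (x₂ : Fin n) (c₂ : G₂.Walk x₂ x₂) (hc₂ : c₂.IsCycle) (hlen₂ : c₂.length = k₂)
    (hk₁ : 3 ≤ k₁) (hk₁n : k₁ ≤ n) (hk₂ : 3 ≤ k₂) (hk₂n : k₂ ≤ n) :
    (k₁ < k₂ → pathEnergy G₁ < pathEnergy G₂) ∧
      (k₁ = k₂ → pathEnergy G₁ = pathEnergy G₂) := by
  subst hlen₁ hlen₂
  rw [pathEnergy_eq_unicyclicEnergy hG₁ hedges₁ hc₁, pathEnergy_eq_unicyclicEnergy hG₂ hedges₂ hc₂]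
  exact ⟨fun h => unicyclicEnergy_lt hk₁ h hk₂n, fun h => by rw [h]⟩
end
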